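/- arXiv:1406.6712 — 2 statements merged into one kernel-verified Lean document; each statement's English description precedes it below -/
import Mathlib

section
/- For every 0 < p ≤ 1 and p < q ≤ ∞ there exists a constant c_{p,q} > 0 such that for all positive integers N, m with 1 ≤ m < N^2, d^m(B_{S_p}^N, S_q^N) ≥ c_{p,q} · min{1, N/m}^{1/p − 1/q}; moreover one may take c_{p,q} = (1/2)^{2/p − 1/q} (with min{1, N/(2m)} in place of min{1, N/m}). -/
noncomputable def singVals {N : ℕ} (X : Matrix (Fin N) (Fin N) ℝ) : Fin N → ℝ :=
  fun i => Real.sqrt ((Matrix.isHermitian_conjTranspose_mul_self X).eigenvalues i)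

/-- The Schatten `p`-quasi-norm of a real `N × N` matrix. -/
noncomputable def schattenNorm {N : ℕ} (p : ℝ) (X : Matrix (Fin N) (Fin N) ℝ) : ℝ :=
  (∑ i, singVals X i ^ p) ^ (1 / p)

/-- The Gelfand `m`-width of a subset `K` of the space of `N × N` real matrices, measured
in the Schatten `q`-quasi-norm. -/
noncomputable def gelfandWidth {N : ℕ} (m : ℕ) (K : Set (Matrix (Fin N) (Fin N) ℝ))
    (q : ℝ) : ℝ :=
  sInf { r : ℝ | ∃ L : Submodule ℝ (Matrix (Fin N) (Fin N) ℝ),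
    Module.finrank ℝ (Matrix (Fin N) (Fin N) ℝ ⧸ L) ≤ m ∧
    r = sSup (schattenNorm q '' (K ∩ (L : Set (Matrix (Fin N) (Fin N) ℝ)))) }

open Polynomial in
/-- Scaling a Hermitian matrix scales its eigenvalues, counted with multiplicity. -/
theorem Matrix.IsHermitian.map_eigenvalues_smul {N : ℕ} {A B : Matrix (Fin N) (Fin N) ℝ}
    (hA : A.IsHermitian) (hB : B.IsHermitian) (c : ℝ) (h : B = c • A) :
    Finset.univ.val.map hB.eigenvalues =
      Finset.univ.val.map (fun i => c * hA.eigenvalues i) := by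
  have hconj : B = hA.eigenvectorUnitary.1 * Matrix.diagonal (fun i => c * hA.eigenvalues i) *
      star hA.eigenvectorUnitary.1 := by
    have hdiag : Matrix.diagonal (fun i => c * hA.eigenvalues i) =
        c • Matrix.diagonal hA.eigenvalues := by
      rw [← Matrix.diagonal_smul]; rfl
    rw [hdiag, Matrix.mul_smul, Matrix.smul_mul, h]
    congr 1
    conv_lhs => rw [hA.spectral_theorem, Unitary.conjStarAlgAut_apply]
    rfl
  have hchar : B.charpoly = ∏ i, (X - C (c * hA.eigenvalues i)) := by
    rw [hconj, Matrix.charpoly_mul_comm, ← mul_assoc]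
    simp [Matrix.charpoly_diagonal]
  have hroots := hB.roots_charpoly_eq_eigenvalues
  rw [hchar, Polynomial.roots_prod _ _
    (Finset.prod_ne_zero_iff.2 fun i _ => Polynomial.X_sub_C_ne_zero _)] at hroots
  simp only [Polynomial.roots_X_sub_C, Multiset.bind_singleton] at hroots
  exact hroots.symm

theorem singVals_nonneg {N : ℕ} (X : Matrix (Fin N) (Fin N) ℝ) (i : Fin N) :
    0 ≤ singVals X i :=
  Real.sqrt_nonneg _

theorem sum_singVals_rpow_nonneg {N : ℕ} (p : ℝ) (X : Matrix (Fin N) (Fin N) ℝ) :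
    0 ≤ ∑ i, singVals X i ^ p :=
  Finset.sum_nonneg fun i _ => Real.rpow_nonneg (singVals_nonneg X i) p

theorem schattenNorm_nonneg {N : ℕ} (p : ℝ) (X : Matrix (Fin N) (Fin N) ℝ) :
    0 ≤ schattenNorm p X :=
  Real.rpow_nonneg (sum_singVals_rpow_nonneg p X) _

theorem singVals_ne_zero_iff {N : ℕ} (X : Matrix (Fin N) (Fin N) ℝ) (i : Fin N) :
    singVals X i ≠ 0 ↔ (Matrix.isHermitian_conjTranspose_mul_self X).eigenvalues i ≠ 0 := by
  unfold singVals
  rw [Ne, Real.sqrt_eq_zero ((Matrix.posSemidef_conjTranspose_mul_self X).eigenvalues_nonneg i)]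

/-- The rank of a matrix is the number of its nonzero singular values. -/
theorem card_singVals_ne_zero {N : ℕ} (X : Matrix (Fin N) (Fin N) ℝ) :
    (Finset.univ.filter fun i => singVals X i ≠ 0).card = X.rank := by
  rw [← Matrix.rank_conjTranspose_mul_self X,
    (Matrix.isHermitian_conjTranspose_mul_self X).rank_eq_card_non_zero_eigs,
    Fintype.card_subtype]
  simp only [singVals_ne_zero_iff]

/-- The Schatten quasi-norm is positively homogeneous. -/
theorem schattenNorm_smul {N : ℕ} {p : ℝ} (hp : 0 < p) {t : ℝ} (ht : 0 ≤ t)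
    (X : Matrix (Fin N) (Fin N) ℝ) :
    schattenNorm p (t • X) = t * schattenNorm p X := by
  have hmap := (Matrix.isHermitian_conjTranspose_mul_self X).map_eigenvalues_smul
    (Matrix.isHermitian_conjTranspose_mul_self (t • X)) (t ^ 2) (by
      rw [Matrix.conjTranspose_smul, Matrix.smul_mul, Matrix.mul_smul, smul_smul]
      simp [pow_two])
  have hsum : ∑ i, singVals (t • X) i ^ p = t ^ p * ∑ i, singVals X i ^ p := by
    have h := congrArg (fun s => (s.map fun x => Real.sqrt x ^ p).sum) hmap
    simp only [Multiset.map_map, Function.comp_def] at h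
    rw [Finset.mul_sum]
    refine Eq.trans h (Finset.sum_congr rfl fun i _ => ?_)
    rw [Real.sqrt_mul (sq_nonneg t), Real.sqrt_sq ht, Real.mul_rpow ht (Real.sqrt_nonneg _)]
    rfl
  unfold schattenNorm
  rw [hsum, Real.mul_rpow (Real.rpow_nonneg ht p) (sum_singVals_rpow_nonneg p X),
    ← Real.rpow_mul ht, mul_one_div_cancel hp.ne', Real.rpow_one]

theorem schattenNorm_pos {N : ℕ} (p : ℝ) {X : Matrix (Fin N) (Fin N) ℝ} (hX : X ≠ 0) :
    0 < schattenNorm p X := by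
  obtain ⟨i, hi⟩ : ∃ i, singVals X i ≠ 0 := by
    by_contra! h
    apply hX
    rw [← Matrix.conjTranspose_mul_self_eq_zero,
      ← (Matrix.isHermitian_conjTranspose_mul_self X).eigenvalues_eq_zero_iff]
    funext i
    by_contra hi
    exact (singVals_ne_zero_iff X i).2 hi (h i)
  refine Real.rpow_pos_of_pos (Finset.sum_pos' (fun j _ => ?_) ⟨i, Finset.mem_univ i, ?_⟩) _
  · exact Real.rpow_nonneg (singVals_nonneg X j) p
  · exact Real.rpow_pos_of_pos ((singVals_nonneg X i).lt_of_ne' hi) p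

/-- The Schatten `p`-ball lies in the Schatten `q`-ball when `p ≤ q`. -/
theorem schattenNorm_le_one_of_le {N : ℕ} {p q : ℝ} (hp : 0 < p) (hpq : p ≤ q)
    {X : Matrix (Fin N) (Fin N) ℝ} (hX : schattenNorm p X ≤ 1) : schattenNorm q X ≤ 1 := by
  have hsum : ∑ i, singVals X i ^ p ≤ 1 := by
    by_contra! h
    exact absurd hX (not_le.2 (Real.one_lt_rpow h (one_div_pos.2 hp)))
  have hle : ∀ i, singVals X i ≤ 1 := by
    intro i
    by_contra! h
    have hi : singVals X i ^ p ≤ ∑ i, singVals X i ^ p :=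
      Finset.single_le_sum (f := fun i => singVals X i ^ p)
        (fun j _ => Real.rpow_nonneg (singVals_nonneg X j) p) (Finset.mem_univ i)
    linarith [Real.one_lt_rpow h hp]
  refine Real.rpow_le_one (sum_singVals_rpow_nonneg q X) (le_trans ?_ hsum)
    (one_div_pos.2 (hp.trans_le hpq)).le
  exact Finset.sum_le_sum fun i _ =>
    Real.rpow_le_rpow_of_exponent_ge_of_imp (singVals_nonneg X i) (hle i) hpq
      (fun _ h => ((hp.trans_le hpq).ne' h).elim)

/-- On matrices of rank at most `k` the Schatten `p`- and `q`-quasi-norms are equivalent. -/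
theorem schattenNorm_le_of_rank_le {N k : ℕ} {p q : ℝ} (hp : 0 < p) (hpq : p < q)
    {X : Matrix (Fin N) (Fin N) ℝ} (hX : X.rank ≤ k) :
    schattenNorm p X ≤ (k : ℝ) ^ (1 / p - 1 / q) * schattenNorm q X := by
  have hq : 0 < q := hp.trans hpq
  set S := Finset.univ.filter fun i => singVals X i ≠ 0 with hS
  have hrestrict : ∀ r : ℝ, 0 < r → ∑ i ∈ S, singVals X i ^ r = ∑ i, singVals X i ^ r := by
    intro r hr
    refine Finset.sum_subset (Finset.subset_univ _) fun i _ hi => ?_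
    have hi0 : singVals X i = 0 := by simpa [hS] using hi
    rw [hi0, Real.zero_rpow hr.ne']
  have hmean := Real.rpow_sum_le_const_mul_sum_rpow_of_nonneg S (f := fun i => singVals X i ^ p)
    (p := q / p) ((one_le_div hp).2 hpq.le) (fun i _ => Real.rpow_nonneg (singVals_nonneg X i) p)
  have hexp : ∀ i, (singVals X i ^ p) ^ (q / p) = singVals X i ^ q := fun i => by
    rw [← Real.rpow_mul (singVals_nonneg X i), mul_div_cancel₀ q hp.ne']
  simp only [hexp, hrestrict p hp, hrestrict q hq] at hmean
  have hcard : (S.card : ℝ) ^ (q / p - 1) ≤ (k : ℝ) ^ (q / p - 1) := by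
    refine Real.rpow_le_rpow (Nat.cast_nonneg _) ?_ (sub_nonneg.2 ((one_le_div hp).2 hpq.le))
    rw [hS, card_singVals_ne_zero]
    exact_mod_cast hX
  have hroot := Real.rpow_le_rpow (Real.rpow_nonneg (sum_singVals_rpow_nonneg p X) _)
    (hmean.trans (mul_le_mul_of_nonneg_right hcard (sum_singVals_rpow_nonneg q X)))
    (one_div_pos.2 hq).le
  rw [← Real.rpow_mul (sum_singVals_rpow_nonneg p X),
    Real.mul_rpow (Real.rpow_nonneg (Nat.cast_nonneg _) _) (sum_singVals_rpow_nonneg q X),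
    ← Real.rpow_mul (Nat.cast_nonneg _)] at hroot
  have h1 : q / p * (1 / q) = 1 / p := by field_simp
  have h2 : (q / p - 1) * (1 / q) = 1 / p - 1 / q := by field_simp
  rwa [h1, h2] at hroot

/-- A subspace of codimension less than `k * N` contains a nonzero matrix of rank at most `k`. -/
theorem exists_mem_ne_zero_rank_le {N k : ℕ} (hk : k ≤ N)
    (L : Submodule ℝ (Matrix (Fin N) (Fin N) ℝ))
    (hL : Module.finrank ℝ (Matrix (Fin N) (Fin N) ℝ ⧸ L) < k * N) :
    ∃ X ∈ L, X ≠ 0 ∧ X.rank ≤ k := by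
  let E : Matrix (Fin N) (Fin k) ℝ := (1 : Matrix (Fin N) (Fin N) ℝ).submatrix id (Fin.castLE hk)
  have hE : E.transpose * E = 1 := by
    ext i j
    simp [E, Matrix.mul_apply, Matrix.one_apply]
  let T : Matrix (Fin k) (Fin N) ℝ →ₗ[ℝ] Matrix (Fin N) (Fin N) ℝ :=
    { toFun := fun B => E * B
      map_add' := Matrix.mul_add E
      map_smul' := fun c B => Matrix.mul_smul E c B }
  have hker : LinearMap.ker (L.mkQ ∘ₗ T) ≠ ⊥ :=
    LinearMap.ker_ne_bot_of_finrank_lt (by simpa [Module.finrank_matrix] using hL)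
  obtain ⟨B, hB, hB0⟩ := (Submodule.ne_bot_iff _).1 hker
  refine ⟨E * B, ?_, fun h => hB0 ?_, ?_⟩
  · simpa [T] using hB
  · rw [← Matrix.one_mul B, ← hE, Matrix.mul_assoc, h, Matrix.mul_zero]
  · exact (Matrix.rank_mul_le_left E B).trans (by simpa using Matrix.rank_le_width E)

theorem rpow_le_gelfandWidth {N m k : ℕ} {p q : ℝ} (hp : 0 < p) (hpq : p < q) (hk0 : 0 < k)
    (hkN : k ≤ N) (hmk : m < k * N) :
    (1 / (k : ℝ)) ^ (1 / p - 1 / q) ≤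
      gelfandWidth m {X : Matrix (Fin N) (Fin N) ℝ | schattenNorm p X ≤ 1} q := by
  have hk : (0 : ℝ) < k := Nat.cast_pos.2 hk0
  refine le_csInf ⟨_, ⊤, ?_, rfl⟩ ?_
  · rw [Module.finrank_zero_of_subsingleton]
    exact Nat.zero_le m
  rintro r ⟨L, hL, rfl⟩
  obtain ⟨X, hXL, hX0, hXk⟩ := exists_mem_ne_zero_rank_le hkN L (hL.trans_lt hmk)
  have hpos := schattenNorm_pos p hX0
  have hscale : 0 ≤ (schattenNorm p X)⁻¹ := (inv_pos.2 hpos).le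
  have hbdd : BddAbove (schattenNorm q ''
      ({X : Matrix (Fin N) (Fin N) ℝ | schattenNorm p X ≤ 1} ∩ (L : Set _))) := by
    refine ⟨1, ?_⟩
    rintro _ ⟨Y, ⟨hY, -⟩, rfl⟩
    exact schattenNorm_le_one_of_le hp hpq.le hY
  refine le_csSup_of_le hbdd ⟨(schattenNorm p X)⁻¹ • X, ⟨?_, L.smul_mem _ hXL⟩, rfl⟩ ?_
  · change schattenNorm p _ ≤ 1
    rw [schattenNorm_smul hp hscale, inv_mul_cancel₀ hpos.ne']
  · rw [schattenNorm_smul (hp.trans hpq) hscale, one_div, Real.inv_rpow hk.le,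
      inv_mul_eq_div, le_div_iff₀ hpos, inv_mul_le_iff₀ (Real.rpow_pos_of_pos hk _)]
    exact schattenNorm_le_of_rank_le hp hpq hXk

theorem min_rpow_le_gelfandWidth {p q : ℝ} (hp : 0 < p) (hpq : p < q) {N m : ℕ} (hN : 0 < N)
    (hm : 1 ≤ m) (hmN : m < N ^ 2) :
    (min 1 ((N : ℝ) / (2 * m))) ^ (1 / p - 1 / q) ≤
      gelfandWidth m {X : Matrix (Fin N) (Fin N) ℝ | schattenNorm p X ≤ 1} q := by
  have hm0 : (0 : ℝ) < m := by exact_mod_cast hm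
  have hN0 : (0 : ℝ) < N := by exact_mod_cast hN
  have hexp : 0 ≤ 1 / p - 1 / q := sub_nonneg.2 (one_div_le_one_div_of_le hp hpq.le)
  refine le_trans (Real.rpow_le_rpow (by positivity) ?_ hexp)
    (rpow_le_gelfandWidth (k := m / N + 1) hp hpq (Nat.succ_pos _)
      (Nat.div_lt_of_lt_mul (by rwa [← pow_two])) ?_)
  · rcases lt_or_ge m N with h | h
    · simp [Nat.div_eq_of_lt h]
    · refine (min_le_right _ _).trans ?_
      rw [div_le_div_iff₀ (by positivity) (by positivity)]
      have h1 : N * (m / N + 1) ≤ 2 * m := by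
        have := Nat.mul_div_le m N
        rw [mul_add]
        lia
      rw [one_mul]
      exact_mod_cast h1
  · exact (Nat.div_lt_iff_lt_mul hN).1 (Nat.lt_succ_self _)

/-- Lower bound for the Gelfand widths of Schatten `p`-balls, for `0 < p ≤ 1` and
`p < q` (`q` finite): there is a constant `c_{p,q} > 0` with
`d^m(B_{S_p}^N, S_q^N) ≥ c_{p,q} min{1, N/m}^{1/p - 1/q}`; moreover one may take
`c_{p,q} = (1/2)^{2/p - 1/q}` with `min{1, N/(2m)}` in place of `min{1, N/m}`. -/
theorem gelfand_width_schatten_ball_lower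
    (p q : ℝ) (hp0 : 0 < p) (hp1 : p ≤ 1) (hpq : p < q) :
    (∃ c : ℝ, 0 < c ∧
      ∀ N m : ℕ, 0 < N → 1 ≤ m → m < N ^ 2 →
        c * (min 1 ((N : ℝ) / m)) ^ (1 / p - 1 / q) ≤
          gelfandWidth m {X : Matrix (Fin N) (Fin N) ℝ | schattenNorm p X ≤ 1} q) ∧
    (∀ N m : ℕ, 0 < N → 1 ≤ m → m < N ^ 2 →
      ((1 : ℝ) / 2) ^ (2 / p - 1 / q) * (min 1 ((N : ℝ) / (2 * m))) ^ (1 / p - 1 / q) ≤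
        gelfandWidth m {X : Matrix (Fin N) (Fin N) ℝ | schattenNorm p X ≤ 1} q) := by
  have hexp : 0 ≤ 1 / p - 1 / q := sub_nonneg.2 (one_div_le_one_div_of_le hp0 hpq.le)
  refine ⟨⟨(1 / 2 : ℝ) ^ (1 / p - 1 / q), by positivity, fun N m hN hm hmN => ?_⟩,
    fun N m hN hm hmN => ?_⟩
  · refine le_trans ?_ (min_rpow_le_gelfandWidth hp0 hpq hN hm hmN)
    rw [← Real.mul_rpow (by positivity) (by positivity)]
    refine Real.rpow_le_rpow (by positivity) (le_min ?_ ?_) hexp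
    · linarith [min_le_left (1 : ℝ) ((N : ℝ) / m)]
    · calc 1 / 2 * min 1 ((N : ℝ) / m) ≤ 1 / 2 * ((N : ℝ) / m) := by
            gcongr
            exact min_le_right _ _
        _ = (N : ℝ) / (2 * m) := by rw [div_mul_div_comm, one_mul]
  · refine le_trans (mul_le_of_le_one_left (by positivity) ?_)
      (min_rpow_le_gelfandWidth hp0 hpq hN hm hmN)
    refine Real.rpow_le_one (by norm_num) (by norm_num) ?_
    have hsplit : 2 / p - 1 / q = 1 / p + (1 / p - 1 / q) := by ring
    rw [hsplit]
    positivity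
end

section
/- Let 0 < p ≤ 1 and p < q ≤ ∞, let N, m, s be positive integers with 2s ≤ N, and let 𝒜 : M_N → ℝ^m be a linear map such that every nonzero V in the kernel of 𝒜 satisfies ‖V‖_{S_q} ≤ 2^{−1/p} (2s)^{−(1/p − 1/q)} ‖V‖_{S_p}. Then every V in the kernel of 𝒜 satisfies the rank-2s null space property ‖V_{[2s]}‖_{S_p}^p ≤ ‖V − V_{[2s]}‖_{S_p}^p, where V_{[2s]} is the 2s-spectral truncation of V (keeping the 2s largest singular values in the singular value decomposition of V). -/
open scoped Matrix

/-- The squared singular values of `U * diagonal d * Wᵀ`, with `U` and `W` orthogonal, are the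
squares of the entries of `d`, with multiplicity. -/
theorem map_eigenvalues_orthogonal_mul_diagonal_mul {N : ℕ} {U W : Matrix (Fin N) (Fin N) ℝ}
    (hU : U * Uᵀ = 1) (hW : W * Wᵀ = 1) (d : Fin N → ℝ) :
    Finset.univ.val.map (Matrix.isHermitian_conjTranspose_mul_self
      (U * Matrix.diagonal d * Wᵀ)).eigenvalues = Finset.univ.val.map (fun i => d i ^ 2) := by
  have hU' : Uᵀ * U = 1 := mul_eq_one_comm.mp hU
  have hW' : Wᵀ * W = 1 := mul_eq_one_comm.mp hW
  have hgram : (U * Matrix.diagonal d * Wᵀ)ᴴ * (U * Matrix.diagonal d * Wᵀ) =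
      W * (Matrix.diagonal (fun i => d i ^ 2) * Wᵀ) := by
    calc (U * Matrix.diagonal d * Wᵀ)ᴴ * (U * Matrix.diagonal d * Wᵀ)
        = W * Matrix.diagonal d * (Uᵀ * U) * Matrix.diagonal d * Wᵀ := by
          simp [Matrix.conjTranspose_eq_transpose_of_trivial, Matrix.mul_assoc]
      _ = W * (Matrix.diagonal (fun i => d i ^ 2) * Wᵀ) := by
          rw [hU', Matrix.mul_one, Matrix.mul_assoc W, Matrix.diagonal_mul_diagonal,
            Matrix.mul_assoc]
          simp only [sq]
  have hroots := (Matrix.isHermitian_conjTranspose_mul_self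
    (U * Matrix.diagonal d * Wᵀ)).roots_charpoly_eq_eigenvalues
  have hcharpoly : ((U * Matrix.diagonal d * Wᵀ)ᴴ * (U * Matrix.diagonal d * Wᵀ)).charpoly =
      ((Finset.univ.val.map fun i => d i ^ 2).map fun a =>
        Polynomial.X - Polynomial.C a).prod := by
    rw [hgram, Matrix.charpoly_mul_comm, Matrix.mul_assoc, hW', Matrix.mul_one,
      Matrix.charpoly_diagonal, Multiset.map_map]
    rfl
  rw [hcharpoly, Polynomial.roots_multiset_prod_X_sub_C] at hroots
  exact hroots.symm

theorem sum_singVals_orthogonal_mul_diagonal_mul {N : ℕ} {U W : Matrix (Fin N) (Fin N) ℝ}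
    (hU : U * Uᵀ = 1) (hW : W * Wᵀ = 1) {d : Fin N → ℝ} (hd : ∀ i, 0 ≤ d i) (f : ℝ → ℝ) :
    ∑ i, f (singVals (U * Matrix.diagonal d * Wᵀ) i) = ∑ i, f (d i) := by
  have h := congrArg (fun M : Multiset ℝ => (M.map fun x => f (Real.sqrt x)).sum)
    (map_eigenvalues_orthogonal_mul_diagonal_mul hU hW d)
  simp only [Multiset.map_map, Function.comp_def, Real.sqrt_sq (hd _)] at h
  exact h

theorem schattenNorm_orthogonal_mul_diagonal_mul {N : ℕ} {U W : Matrix (Fin N) (Fin N) ℝ}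
    (hU : U * Uᵀ = 1) (hW : W * Wᵀ = 1) {d : Fin N → ℝ} (hd : ∀ i, 0 ≤ d i) (p : ℝ) :
    schattenNorm p (U * Matrix.diagonal d * Wᵀ) = (∑ i, d i ^ p) ^ (1 / p) := by
  rw [schattenNorm, sum_singVals_orthogonal_mul_diagonal_mul hU hW hd (· ^ p)]

theorem schattenNorm_rpow_orthogonal_mul_diagonal_mul {N : ℕ}
    {U W : Matrix (Fin N) (Fin N) ℝ} (hU : U * Uᵀ = 1) (hW : W * Wᵀ = 1)
    {d : Fin N → ℝ} (hd : ∀ i, 0 ≤ d i) {p : ℝ} (hp : p ≠ 0) :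
    schattenNorm p (U * Matrix.diagonal d * Wᵀ) ^ p = ∑ i, d i ^ p := by
  rw [schattenNorm_orthogonal_mul_diagonal_mul hU hW hd, one_div, Real.rpow_inv_rpow _ hp]
  exact Finset.sum_nonneg fun i _ => Real.rpow_nonneg (hd i) p

/-- If the `ℓ_q` norm of a nonnegative vector is at most `2^{-1/p} k^{-(1/p - 1/q)}` times its
`ℓ_p` quasi-norm, then any `k` entries carry at most half of the sum of the `p`-th powers. -/
theorem two_mul_sum_rpow_le_of_lq_le {ι : Type*} [Fintype ι] {σ : ι → ℝ} (hσ : ∀ i, 0 ≤ σ i)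
    {p q : ℝ} (hp : 0 < p) (hpq : p < q) {S : Finset ι} (hS : S.Nonempty)
    (h : (∑ i, σ i ^ q) ^ (1 / q) ≤
      (2 : ℝ) ^ (-(1 / p)) * (S.card : ℝ) ^ (-(1 / p - 1 / q)) * (∑ i, σ i ^ p) ^ (1 / p)) :
    2 * ∑ i ∈ S, σ i ^ p ≤ ∑ i, σ i ^ p := by
  have hq : 0 < q := hp.trans hpq
  have hr : 1 ≤ q / p := (one_le_div hp).mpr hpq.le
  have hk : (0 : ℝ) < S.card := by exact_mod_cast hS.card_pos
  have hP : 0 ≤ ∑ i, σ i ^ p := Finset.sum_nonneg fun i _ => Real.rpow_nonneg (hσ i) p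
  have hQ : 0 ≤ ∑ i, σ i ^ q := Finset.sum_nonneg fun i _ => Real.rpow_nonneg (hσ i) q
  have hT : 0 ≤ ∑ i ∈ S, σ i ^ p := Finset.sum_nonneg fun i _ => Real.rpow_nonneg (hσ i) p
  have hbound : ∑ i, σ i ^ q ≤
      (2 : ℝ) ^ (-(q / p)) * (S.card : ℝ) ^ (-(q / p - 1)) * (∑ i, σ i ^ p) ^ (q / p) := by
    have := Real.rpow_le_rpow (Real.rpow_nonneg hQ _) h hq.le
    rw [Real.mul_rpow (by positivity) (by positivity), Real.mul_rpow (by positivity)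
      (by positivity), ← Real.rpow_mul hQ, ← Real.rpow_mul hP, ← Real.rpow_mul hk.le,
      ← Real.rpow_mul zero_le_two] at this
    convert this using 1
    · rw [one_div_mul_cancel hq.ne', Real.rpow_one]
    · congr 3 <;> field_simp
  have hpow : (∑ i ∈ S, σ i ^ p) ^ (q / p) ≤ (S.card : ℝ) ^ (q / p - 1) * ∑ i, σ i ^ q := by
    refine (Real.rpow_sum_le_const_mul_sum_rpow_of_nonneg S hr
      fun i _ => Real.rpow_nonneg (hσ i) p).trans ?_
    gcongr
    calc ∑ i ∈ S, (σ i ^ p) ^ (q / p) = ∑ i ∈ S, σ i ^ q := by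
          refine Finset.sum_congr rfl fun i _ => ?_
          rw [← Real.rpow_mul (hσ i), mul_div_cancel₀ _ hp.ne']
      _ ≤ ∑ i, σ i ^ q := Finset.sum_le_sum_of_subset_of_nonneg (Finset.subset_univ S)
          fun i _ _ => Real.rpow_nonneg (hσ i) q
  refine (Real.rpow_le_rpow_iff (by positivity) hP (zero_lt_one.trans_le hr)).mp ?_
  rw [Real.mul_rpow zero_le_two hT]
  calc (2 : ℝ) ^ (q / p) * (∑ i ∈ S, σ i ^ p) ^ (q / p)
      ≤ 2 ^ (q / p) * ((S.card : ℝ) ^ (q / p - 1) * ((2 : ℝ) ^ (-(q / p)) *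
          (S.card : ℝ) ^ (-(q / p - 1)) * (∑ i, σ i ^ p) ^ (q / p))) := by
        gcongr
        exact hpow.trans (by gcongr)
    _ = (∑ i, σ i ^ p) ^ (q / p) := by
        rw [Real.rpow_neg zero_le_two, Real.rpow_neg hk.le]
        have h2 : (2 : ℝ) ^ (q / p) ≠ 0 := by positivity
        have h3 : (S.card : ℝ) ^ (q / p - 1) ≠ 0 := by positivity
        field_simp

/-- If every nonzero element of the kernel of `𝒜` satisfies
`‖V‖_{S_q} ≤ 2^{-1/p} (2s)^{-(1/p - 1/q)} ‖V‖_{S_p}`, then every kernel element satisfies the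
rank-`2s` null space property `‖V_{[2s]}‖_{S_p}^p ≤ ‖V - V_{[2s]}‖_{S_p}^p`, where the
`2s`-spectral truncation `V_{[2s]}` is expressed through a singular value decomposition
`V = U diag(σ) Wᵀ` with `U`, `W` orthogonal and `σ` nonnegative and nonincreasing. -/
theorem null_space_property_of_kernel_bound
    (p q : ℝ) (hp0 : 0 < p) (hp1 : p ≤ 1) (hpq : p < q)
    (N m s : ℕ) (hs : 0 < s) (h2s : 2 * s ≤ N)
    (A : Matrix (Fin N) (Fin N) ℝ →ₗ[ℝ] EuclideanSpace ℝ (Fin m))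
    (hker : ∀ V : Matrix (Fin N) (Fin N) ℝ, A V = 0 → V ≠ 0 →
      schattenNorm q V ≤
        (2 : ℝ) ^ (-(1 / p)) * ((2 * s : ℕ) : ℝ) ^ (-(1 / p - 1 / q)) * schattenNorm p V)
    (V : Matrix (Fin N) (Fin N) ℝ) (hV : A V = 0)
    (U W : Matrix (Fin N) (Fin N) ℝ) (σ : Fin N → ℝ)
    (hU : U * Uᵀ = 1) (hW : W * Wᵀ = 1)
    (hσ0 : ∀ i, 0 ≤ σ i) (hσmono : Antitone σ)
    (hSVD : V = U * Matrix.diagonal σ * Wᵀ) :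
    schattenNorm p
        (U * Matrix.diagonal (fun i : Fin N => if (i : ℕ) < 2 * s then σ i else 0) * Wᵀ) ^ p ≤
      schattenNorm p
        (V - U * Matrix.diagonal (fun i : Fin N => if (i : ℕ) < 2 * s then σ i else 0) * Wᵀ) ^ p := by
  set S : Finset (Fin N) := Finset.univ.filter fun i : Fin N => (i : ℕ) < 2 * s with hS
  have hcard : S.card = 2 * s := by
    rw [hS, Fin.card_filter_val_lt, min_eq_right h2s]
  have hsub : V - U * Matrix.diagonal (fun i : Fin N => if (i : ℕ) < 2 * s then σ i else 0) * Wᵀ =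
      U * Matrix.diagonal (fun i : Fin N => if (i : ℕ) < 2 * s then 0 else σ i) * Wᵀ := by
    rw [hSVD, ← Matrix.sub_mul, ← Matrix.mul_sub, Matrix.diagonal_sub]
    congr 3
    ext i
    split_ifs <;> simp
  have hhalf : 2 * ∑ i ∈ S, σ i ^ p ≤ ∑ i, σ i ^ p := by
    by_cases hV0 : V = 0
    · have hdiag : Matrix.diagonal σ = 0 := by
        calc Matrix.diagonal σ = (Uᵀ * U) * Matrix.diagonal σ * (Wᵀ * W) := by
              rw [mul_eq_one_comm.mp hU, mul_eq_one_comm.mp hW, Matrix.one_mul, Matrix.mul_one]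
          _ = Uᵀ * (U * Matrix.diagonal σ * Wᵀ) * W := by simp only [Matrix.mul_assoc]
          _ = 0 := by rw [← hSVD, hV0, Matrix.mul_zero, Matrix.zero_mul]
      have hσ : σ = 0 := Matrix.diagonal_eq_zero.mp hdiag
      simp [hσ, Real.zero_rpow hp0.ne']
    · have h := hker V hV hV0
      rw [hSVD, schattenNorm_orthogonal_mul_diagonal_mul hU hW hσ0,
        schattenNorm_orthogonal_mul_diagonal_mul hU hW hσ0, ← hcard] at h
      exact two_mul_sum_rpow_le_of_lq_le hσ0 hp0 hpq (Finset.card_pos.mp (by omega)) h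
  rw [hsub,
    schattenNorm_rpow_orthogonal_mul_diagonal_mul hU hW
      (fun i => by split_ifs <;> simp [hσ0 i]) hp0.ne',
    schattenNorm_rpow_orthogonal_mul_diagonal_mul hU hW
      (fun i => by split_ifs <;> simp [hσ0 i]) hp0.ne']
  have hhead : ∑ i : Fin N, (if (i : ℕ) < 2 * s then σ i else 0) ^ p = ∑ i ∈ S, σ i ^ p := by
    rw [hS, Finset.sum_filter]
    refine Finset.sum_congr rfl fun i _ => ?_
    split_ifs <;> simp [Real.zero_rpow hp0.ne']
  have hsum : ∑ i : Fin N, (if (i : ℕ) < 2 * s then σ i else 0) ^ p +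
      ∑ i : Fin N, (if (i : ℕ) < 2 * s then 0 else σ i) ^ p = ∑ i, σ i ^ p := by
    rw [← Finset.sum_add_distrib]
    refine Finset.sum_congr rfl fun i _ => ?_
    split_ifs <;> simp [Real.zero_rpow hp0.ne']
  linarith
end
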